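/- arXiv:1104.2371 — 5 statements merged into one kernel-verified Lean document; each statement's English description precedes it below -/
import Mathlib

section
/- Fix n, k ≥ 1 and l ≥ 0 with n + l ≥ 2. Then H_1(K'_{n,k,l}; ℚ) is infinite-dimensional as a ℚ-vector space; in particular, the group K'_{n,k,l} is not finitely generated. -/
namespace Birman

/-- The generating set of the free group `F_{n,k,l}`: `X ∪ Y ∪ Z`. -/
abbrev Gen (n k l : ℕ) := Fin n ⊕ (Fin k ⊕ Fin l)

/-- The free group `F_{n,k,l}` on `X ∪ Y ∪ Z`. -/
abbrev FG (n k l : ℕ) := FreeGroup (Gen n k l)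

variable {n k l : ℕ}

/-- The generator `x_i`. -/
def xg (n k l : ℕ) (i : Fin n) : Gen n k l := Sum.inl i
/-- The generator `y_j`. -/
def yg (n k l : ℕ) (j : Fin k) : Gen n k l := Sum.inr (Sum.inl j)
/-- The generator `z_m`. -/
def zg (n k l : ℕ) (m : Fin l) : Gen n k l := Sum.inr (Sum.inr m)

/-- `A_{n,k,l}`: automorphisms sending each generator in `Y ∪ Z` to a conjugate of itself. -/
def A (n k l : ℕ) : Subgroup (MulAut (FG n k l)) where
  carrier := {f | ∀ s : Fin k ⊕ Fin l,
    IsConj (FreeGroup.of (Sum.inr s : Gen n k l)) (f (FreeGroup.of (Sum.inr s)))}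
  one_mem' := by
    intro s
    rw [MulAut.one_apply]
  mul_mem' := by
    intro f g hf hg s
    rw [MulAut.mul_apply]
    exact (hf s).trans (f.toMonoidHom.map_isConj (hg s))
  inv_mem' := by
    intro f hf s
    have h := (f⁻¹ : MulAut (FG n k l)).toMonoidHom.map_isConj (hf s)
    simp only [MulEquiv.toMonoidHom_eq_coe, MonoidHom.coe_coe] at h
    have h2 : (f⁻¹ : MulAut (FG n k l)) (f (FreeGroup.of (Sum.inr s))) = FreeGroup.of (Sum.inr s) :=
      MulAut.inv_apply_self _ f _
    rw [h2] at h
    exact h.symm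

/-- The projection `F_{n,k,l} → F_{n,0,l}` killing the generators in `Y`. -/
def proj (n k l : ℕ) : FG n k l →* FG n 0 l :=
  FreeGroup.lift fun g => match g with
    | Sum.inl i => FreeGroup.of (Sum.inl i)
    | Sum.inr (Sum.inl _) => 1
    | Sum.inr (Sum.inr m) => FreeGroup.of (Sum.inr (Sum.inr m))

/-- Automorphisms commuting with the projection to `F_{n,0,l}`, i.e. inducing the identity
on `F_{n,k,l}/N ≅ F_{n,0,l}`. -/
def fixProj (n k l : ℕ) : Subgroup (MulAut (FG n k l)) where
  carrier := {f | ∀ w : FG n k l, proj n k l (f w) = proj n k l w}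
  one_mem' := by intro w; simp
  mul_mem' := by
    intro f g hf hg w
    rw [MulAut.mul_apply]
    exact (hf (g w)).trans (hg w)
  inv_mem' := by
    intro f hf w
    have h := hf ((f⁻¹ : MulAut (FG n k l)) w)
    rw [MulAut.apply_inv_self] at h
    exact h.symm

/-- `K_{n,k,l}`, the kernel of `ρ : A_{n,k,l} → A_{n,0,l}`: those elements of `A_{n,k,l}`
that induce the identity automorphism of `F_{n,k,l}/N ≅ F_{n,0,l}`. -/
def K (n k l : ℕ) : Subgroup (MulAut (FG n k l)) := A n k l ⊓ fixProj n k l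

/-- `f` is the automorphism `M_{v,w}` : `v ↦ w v`, fixing all other generators. -/
def IsMul (f : MulAut (FG n k l)) (v w : Gen n k l) : Prop :=
  f (FreeGroup.of v) = FreeGroup.of w * FreeGroup.of v ∧
    ∀ u : Gen n k l, u ≠ v → f (FreeGroup.of u) = FreeGroup.of u

/-- `f` is the automorphism `M_{v⁻¹,w}` : `v ↦ v w⁻¹`, fixing all other generators. -/
def IsMulInv (f : MulAut (FG n k l)) (v w : Gen n k l) : Prop :=
  f (FreeGroup.of v) = FreeGroup.of v * (FreeGroup.of w)⁻¹ ∧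
    ∀ u : Gen n k l, u ≠ v → f (FreeGroup.of u) = FreeGroup.of u

/-- `f` is the automorphism `C_{v,w}` : `v ↦ w v w⁻¹`, fixing all other generators. -/
def IsConjGen (f : MulAut (FG n k l)) (v w : Gen n k l) : Prop :=
  f (FreeGroup.of v) = FreeGroup.of w * FreeGroup.of v * (FreeGroup.of w)⁻¹ ∧
    ∀ u : Gen n k l, u ≠ v → f (FreeGroup.of u) = FreeGroup.of u

end Birman

namespace Birman

open scoped TensorProduct

/-- `A'_{n,k,l}`: automorphisms fixing each generator in `Y ∪ Z` on the nose. -/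
def A' (n k l : ℕ) : Subgroup (MulAut (FG n k l)) where
  carrier := {f | ∀ s : Fin k ⊕ Fin l,
    f (FreeGroup.of (Sum.inr s : Gen n k l)) = FreeGroup.of (Sum.inr s)}
  one_mem' := by intro s; rw [MulAut.one_apply]
  mul_mem' := by
    intro f g hf hg s
    rw [MulAut.mul_apply, hg s, hf s]
  inv_mem' := by
    intro f hf s
    have h : f ((f⁻¹ : MulAut (FG n k l)) (FreeGroup.of (Sum.inr s))) = f (FreeGroup.of (Sum.inr s)) := by
      rw [MulAut.apply_inv_self, hf s]
    exact f.injective h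

/-- `K'_{n,k,l}`, the kernel of `ρ' : A'_{n,k,l} → A'_{n,0,l}`. -/
def K' (n k l : ℕ) : Subgroup (MulAut (FG n k l)) := A' n k l ⊓ fixProj n k l


/-- The coefficient space. -/
abbrev VV := ℤ →₀ ℚ

/-- The shift. -/
noncomputable def shiftL : VV ≃ₗ[ℚ] VV := Finsupp.domLCongr (Equiv.addRight (1 : ℤ))

theorem shiftL_single (a : ℤ) : shiftL (Finsupp.single a 1) = Finsupp.single (a + 1) 1 := by
  simp [shiftL]

theorem shiftL_zpow (m a : ℤ) :
    (shiftL ^ m) (Finsupp.single a 1) = Finsupp.single (a + m) 1 := by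
  induction m using Int.induction_on generalizing a with
  | zero => simp
  | succ i ih =>
    rw [zpow_add_one, LinearEquiv.mul_apply, shiftL_single, ih]
    congr 1; ring
  | pred i ih =>
    rw [zpow_sub_one, LinearEquiv.mul_apply]
    have : shiftL⁻¹ (Finsupp.single a 1) = Finsupp.single (a - 1) 1 := by
      have h := shiftL_single (a - 1)
      rw [sub_add_cancel] at h
      rw [← h]
      exact shiftL.symm_apply_apply _
    rw [this, ih]
    congr 1; ring

/-- The affine group. -/
abbrev Aff := VV ≃ᵃ[ℚ] VV

/-- Translation. -/
noncomputable def tr (v : VV) : Aff := AffineEquiv.constVAdd ℚ VV v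

theorem tr_apply (v w : VV) : tr v w = v + w := rfl

theorem conj_tr (e : Aff) (v : VV) : e * tr v * e⁻¹ = tr (e.linear v) := by
  rw [mul_inv_eq_iff_eq_mul]
  ext1 w
  rw [AffineEquiv.coe_mul, AffineEquiv.coe_mul]
  simp only [Function.comp, tr_apply]
  exact e.map_vadd w v

/-- linear part -/
noncomputable def lin : Aff →* (VV ≃ₗ[ℚ] VV) := AffineEquiv.linearHom

theorem lin_tr (v : VV) : lin (tr v) = 1 := rfl

theorem eq_tr (e : Aff) (h : lin e = 1) : e = tr (e 0) := by
  ext1 w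
  rw [tr_apply]
  have := e.map_vadd 0 w
  have h2 : e.linear w = w := by
    have : lin e w = w := by rw [h]; rfl
    exact this
  rw [h2] at this
  simpa [add_comm] using this

section
variable {n k l : ℕ}

/-- The section of `proj`. -/
def sec (n k l : ℕ) : FG n 0 l →* FG n k l :=
  FreeGroup.lift fun g => match g with
    | Sum.inl i => FreeGroup.of (Sum.inl i)
    | Sum.inr (Sum.inl j) => j.elim0
    | Sum.inr (Sum.inr m) => FreeGroup.of (Sum.inr (Sum.inr m))

theorem hom_sec_proj {G : Type*} [Group G] (ψ : FG n k l →* G)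
    (h : ∀ j : Fin k, ψ (FreeGroup.of (Sum.inr (Sum.inl j))) = 1) (w : FG n k l) :
    ψ (sec n k l (proj n k l w)) = ψ w := by
  have : (ψ.comp (sec n k l)).comp (proj n k l) = ψ := by
    apply FreeGroup.ext_hom
    rintro (i | j | m)
    · simp [sec, proj]
    · simp [sec, proj, h]
    · simp [sec, proj]
  exact DFunLike.congr_fun this w

theorem hom_factor {G : Type*} [Group G] (ψ : FG n k l →* G)
    (h : ∀ j : Fin k, ψ (FreeGroup.of (Sum.inr (Sum.inl j))) = 1) {a b : FG n k l}
    (hab : proj n k l a = proj n k l b) : ψ a = ψ b := by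
  rw [← hom_sec_proj ψ h a, hab, hom_sec_proj ψ h b]

/-- The set of `y`s. -/
def Ys (n k l : ℕ) : Set (FG n k l) := Set.range fun j : Fin k => FreeGroup.of (Sum.inr (Sum.inl j))

theorem mem_normalClosure {w : FG n k l} (h : proj n k l w = 1) :
    w ∈ Subgroup.normalClosure (Ys n k l) := by
  have := hom_factor (QuotientGroup.mk' (Subgroup.normalClosure (Ys n k l))) (a := w) (b := 1)
    (fun j => (QuotientGroup.eq_one_iff _).2 (Subgroup.subset_normalClosure ⟨j, rfl⟩))
    (by rw [h, map_one])
  rw [map_one] at this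
  exact (QuotientGroup.eq_one_iff _).1 this

open Classical in
/-- The representation. -/
noncomputable def rep (y t : Gen n k l) : FG n k l →* Aff :=
  FreeGroup.lift fun g => if g = y then tr (Finsupp.single 0 1) else
    if g = t then shiftL.toAffineEquiv else 1

/-- All `y`s go to translations. -/
theorem rep_y {y t : Gen n k l} (ht : ∀ j, t ≠ Sum.inr (Sum.inl j)) (j : Fin k) :
    ∃ v, rep y t (FreeGroup.of (Sum.inr (Sum.inl j))) = tr v := by
  simp only [rep, FreeGroup.lift_apply_of]
  rw [if_neg (ht j).symm]
  split_ifs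
  · exact ⟨_, rfl⟩
  · refine ⟨0, ?_⟩
    ext1 w
    rw [tr_apply, zero_add]; rfl

theorem lin_rep {y t : Gen n k l} (ht : ∀ j, t ≠ Sum.inr (Sum.inl j)) {a b : FG n k l}
    (hab : proj n k l a = proj n k l b) : lin (rep y t a) = lin (rep y t b) := by
  refine hom_factor (lin.comp (rep y t)) (fun j => ?_) hab
  obtain ⟨v, hv⟩ := rep_y (y := y) ht j
  rw [MonoidHom.comp_apply, hv, lin_tr]

theorem rep_inv {y t : Gen n k l} (ht : ∀ j, t ≠ Sum.inr (Sum.inl j)) (f : MulAut (FG n k l))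
    (hf : f ∈ K' n k l) {u : FG n k l} (hu : proj n k l u = 1) :
    rep y t (f u) = rep y t u := by
  have hle : Subgroup.normalClosure (Ys n k l) ≤
      MonoidHom.eqLocus ((rep y t).comp f.toMonoidHom) (rep y t) := by
    rw [Subgroup.normalClosure, Subgroup.closure_le]
    intro w hw
    rw [Group.mem_conjugatesOfSet_iff] at hw
    obtain ⟨_, ⟨j, rfl⟩, hc⟩ := hw
    obtain ⟨c, rfl⟩ := isConj_iff.1 hc
    change rep y t (f _) = rep y t _
    obtain ⟨v, hv⟩ := rep_y (y := y) ht j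
    have hfy : f (FreeGroup.of (Sum.inr (Sum.inl j))) = FreeGroup.of (Sum.inr (Sum.inl j)) :=
      hf.1 (Sum.inl j)
    simp only [map_mul, map_inv, hfy, hv]
    rw [conj_tr, conj_tr]
    congr 1
    have := lin_rep (y := y) ht (hf.2 c)
    exact DFunLike.congr_fun this v
  exact hle (mem_normalClosure hu)

/-- The Johnson-type homomorphism. -/
noncomputable def delta {y t : Gen n k l} (ht : ∀ j, t ≠ Sum.inr (Sum.inl j)) (i : Fin n)
    (hy : y ≠ Sum.inl i) (hti : t ≠ Sum.inl i) : ↥(K' n k l) →* Multiplicative VV where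
  toFun f := Multiplicative.ofAdd (rep y t (f.1 (FreeGroup.of (Sum.inl i))) 0)
  map_one' := by
    have : rep y t (FreeGroup.of (Sum.inl i)) = 1 := by
      simp [rep, hy.symm, hti.symm]
    simp [this]
  map_mul' := by
    intro f g
    have h1 : rep y t (FreeGroup.of (Sum.inl i)) = 1 := by
      simp [rep, hy.symm, hti.symm]
    rw [← ofAdd_add]
    congr 1
    set x : FG n k l := FreeGroup.of (Sum.inl i) with hx
    have htr : ∀ f : ↥(K' n k l), rep y t (f.1 x) = tr (rep y t (f.1 x) 0) := by
      intro f
      apply eq_tr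
      rw [lin_rep ht (f.2.2 x), h1, map_one]
    have hu := rep_inv (y := y) ht f.1 f.2 (u := g.1 x * x⁻¹)
      (by rw [map_mul, map_inv, g.2.2 x, mul_inv_cancel])
    rw [map_mul, map_mul, map_inv, map_mul, map_inv, map_inv, h1, inv_one, mul_one,
      mul_inv_eq_iff_eq_mul] at hu
    have : (↑(f * g) : MulAut (FG n k l)) x = f.1 (g.1 x) := rfl
    rw [this, hu, htr g, htr f]
    change tr _ (tr _ 0) = tr _ 0 + tr _ 0
    simp only [tr_apply, add_zero]
    exact add_comm _ _

/-- Transvection endomorphism. -/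
noncomputable def tv (i : Fin n) (w : FG n k l) : FG n k l →* FG n k l :=
  FreeGroup.lift fun g => match g with
    | Sum.inl i' => if i' = i then w * FreeGroup.of (Sum.inl i) else FreeGroup.of (Sum.inl i')
    | Sum.inr s => FreeGroup.of (Sum.inr s)

theorem tv_x (i : Fin n) (w : FG n k l) :
    tv i w (FreeGroup.of (Sum.inl i)) = w * FreeGroup.of (Sum.inl i) := by
  simp [tv]

theorem tv_ne (i : Fin n) (w : FG n k l) (g : Gen n k l) (hg : g ≠ Sum.inl i) :
    tv i w (FreeGroup.of g) = FreeGroup.of g := by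
  rcases g with i' | s
  · have : i' ≠ i := fun h => hg (by rw [h])
    simp [tv, this]
  · simp [tv]

theorem tv_comp (i : Fin n) (w : FG n k l) (hw : ∀ u, tv i u w = w) :
    (tv i w).comp (tv i w⁻¹) = MonoidHom.id _ := by
  apply FreeGroup.ext_hom
  intro g
  by_cases hg : g = Sum.inl i
  · subst hg
    simp [tv_x, hw]
  · simp [tv_ne _ _ _ hg]

/-- Transvection automorphism. -/
noncomputable def tvE (i : Fin n) (w : FG n k l) (hw : ∀ u, tv i u w = w) : MulAut (FG n k l) :=
  MonoidHom.toMulEquiv (tv i w) (tv i w⁻¹)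
    (by
      have := tv_comp i w⁻¹ (fun u => by rw [map_inv, hw])
      rwa [inv_inv] at this)
    (tv_comp i w hw)

theorem tvE_mem (i : Fin n) (w : FG n k l) (hw : ∀ u, tv i u w = w) (h1 : proj n k l w = 1) :
    tvE i w hw ∈ K' n k l := by
  constructor
  · intro s
    exact tv_ne i w (Sum.inr s) (by simp)
  · intro v
    have : (proj n k l).comp (tv i w) = proj n k l := by
      apply FreeGroup.ext_hom
      intro g
      by_cases hg : g = Sum.inl i
      · subst hg
        simp [tv_x, h1]
      · simp [tv_ne _ _ _ hg]
    exact DFunLike.congr_fun this v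

theorem delta_single {t : Gen n k l} (j : Fin k) (ht : ∀ j, t ≠ Sum.inr (Sum.inl j)) (i : Fin n)
    (hy : (Sum.inr (Sum.inl j) : Gen n k l) ≠ Sum.inl i) (hti : t ≠ Sum.inl i) (m : ℤ) :
    ∃ f, delta ht i hy hti f = Multiplicative.ofAdd (Finsupp.single m 1) := by
  set w : FG n k l := FreeGroup.of t ^ m * FreeGroup.of (Sum.inr (Sum.inl j)) *
    (FreeGroup.of t ^ m)⁻¹ with hwdef
  have hw : ∀ u, tv i u w = w := by
    intro u
    rw [hwdef]
    simp only [map_mul, map_inv, map_zpow, tv_ne _ _ _ hti, tv_ne _ _ _ hy]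
  have h1 : proj n k l w = 1 := by
    have : proj n k l (FreeGroup.of (Sum.inr (Sum.inl j))) = 1 := by simp [proj]
    rw [hwdef, map_mul, map_mul, this, mul_one, map_inv, mul_inv_cancel]
  refine ⟨⟨tvE i w hw, tvE_mem i w hw h1⟩, ?_⟩
  change Multiplicative.ofAdd (rep _ t (tv i w (FreeGroup.of (Sum.inl i))) 0) = _
  congr 1
  have hx : rep (Sum.inr (Sum.inl j)) t (FreeGroup.of (Sum.inl i)) = 1 := by
    simp [rep, hti.symm]
  have hyr : rep (Sum.inr (Sum.inl j)) t (FreeGroup.of (Sum.inr (Sum.inl j)))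
      = tr (Finsupp.single 0 1) := by
    simp [rep]
  have htr : rep (Sum.inr (Sum.inl j)) t (FreeGroup.of t) = shiftL.toAffineEquiv := by
    simp [rep, ht j]
  rw [tv_x, map_mul, hx, mul_one, hwdef, map_mul, map_mul, map_inv, hyr, map_zpow, htr, conj_tr,
    tr_apply, add_zero]
  change lin (shiftL.toAffineEquiv ^ m) _ = _
  rw [map_zpow]
  change (shiftL ^ m) _ = _
  rw [shiftL_zpow, zero_add]

theorem not_finite_of_delta {G : Type*} [Group G] (d : G →* Multiplicative VV)
    (h : ∀ m, ∃ f, d f = Multiplicative.ofAdd (Finsupp.single m 1)) :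
    ¬ Module.Finite ℚ (ℚ ⊗[ℤ] Additive (Abelianization G)) := by
  intro hfin
  let a : Additive (Abelianization G) →ₗ[ℤ] VV :=
    (MonoidHom.toAdditiveLeft (Abelianization.lift d)).toIntLinearMap
  let b : ℚ ⊗[ℤ] Additive (Abelianization G) →ₗ[ℚ] VV := LinearMap.liftBaseChange ℚ a
  have hb : Function.Surjective b := by
    rw [← LinearMap.range_eq_top, eq_top_iff]
    intro v _
    induction v using Finsupp.induction_linear with
    | zero => exact zero_mem _
    | add p q hp hq => exact add_mem (hp trivial) (hq trivial)
    | single m c =>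
      obtain ⟨f, hf⟩ := h m
      refine ⟨c ⊗ₜ Additive.ofMul (Abelianization.of f), ?_⟩
      have : a (Additive.ofMul (Abelianization.of f)) = Finsupp.single m 1 := by
        change Multiplicative.toAdd (Abelianization.lift d (Abelianization.of f)) = _
        rw [Abelianization.lift_apply_of, hf]; rfl
      simp [b, this]
  have : Module.Finite ℚ VV := Module.Finite.of_surjective b hb
  have h2 := (Finsupp.basisSingleOne (R := ℚ) (ι := ℤ)).linearIndependent.finite
  exact not_finite ℤ

theorem finite_of_fg {G : Type*} [Group G] (h : Group.FG G) :
    Module.Finite ℚ (ℚ ⊗[ℤ] Additive (Abelianization G)) := by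
  have h1 : Group.FG (Abelianization G) :=
    Group.fg_of_surjective (f := Abelianization.of) (QuotientGroup.mk_surjective)
  have h2 : AddGroup.FG (Additive (Abelianization G)) := GroupFG.iff_add_fg.1 h1
  have h3 : Module.Finite ℤ (Additive (Abelianization G)) := Module.Finite.iff_addGroup_fg.2 h2
  infer_instance

end

/-- **Theorem E.**  For `n, k ≥ 1` and `n + l ≥ 2`, the rational first homology
`H_1(K'_{n,k,l}; ℚ) = ℚ ⊗ K'^{ab}` is infinite-dimensional over `ℚ`; in particular
`K'_{n,k,l}` is not finitely generated. -/
theorem K'_H1_infinite_rank (n k l : ℕ) (hn : 1 ≤ n) (hk : 1 ≤ k) (hnl : 2 ≤ n + l) :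
    ¬ Module.Finite ℚ (ℚ ⊗[ℤ] Additive (Abelianization ↥(K' n k l))) ∧
    ¬ Group.FG ↥(K' n k l) := by
  have key : ¬ Module.Finite ℚ (ℚ ⊗[ℤ] Additive (Abelianization ↥(K' n k l))) := by
    let i : Fin n := ⟨0, hn⟩
    let j : Fin k := ⟨0, hk⟩
    obtain ⟨t, ht, hti⟩ : ∃ t : Gen n k l, (∀ j, t ≠ Sum.inr (Sum.inl j)) ∧ t ≠ Sum.inl i := by
      by_cases h : 2 ≤ n
      · exact ⟨Sum.inl ⟨1, h⟩, by simp, by simp [i]⟩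
      · exact ⟨Sum.inr (Sum.inr ⟨0, by omega⟩), by simp, by simp⟩
    exact not_finite_of_delta (delta (y := Sum.inr (Sum.inl j)) ht i (by simp) hti)
      (delta_single j ht i (by simp) hti)
  exact ⟨key, fun h => key (finite_of_fg h)⟩

end Birman
end

section
/- Let H = F^{ab} ≅ ℤ^{n+k+l} be the abelianization of F, and let ψ : K_{n,k,l} → Aut(H) be the restriction to K_{n,k,l} of the natural homomorphism Aut(F) → Aut(H) induced by functoriality of abelianization. Then the image of ψ is a free abelian subgroup of Aut(H) of rank n·k. -/
namespace Birman

/-- The natural homomorphism `Aut(G) → Aut(G^{ab})` induced by functoriality of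
abelianization. -/
def abAut (G : Type*) [Group G] : MulAut G →* MulAut (Abelianization G) where
  toFun f := f.abelianizationCongr
  map_one' := by
    apply MulEquiv.toMonoidHom_injective
    apply Abelianization.hom_ext
    ext x
    simp
  map_mul' f g := by
    apply MulEquiv.toMonoidHom_injective
    apply Abelianization.hom_ext
    ext x
    simp

/-- Inclusion of the free group on `Y`. -/
def inY (n k l : ℕ) : FreeGroup (Fin k) →* FG n k l :=
  FreeGroup.lift fun j => FreeGroup.of (Sum.inr (Sum.inl j))

/-- Retraction to the free group on `Y`. -/
def retY (n k l : ℕ) : FG n k l →* FreeGroup (Fin k) :=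
  FreeGroup.lift fun g => match g with
    | Sum.inl _ => 1
    | Sum.inr (Sum.inl j) => FreeGroup.of j
    | Sum.inr (Sum.inr _) => 1

/-- Section of the projection. -/
def secP (n k l : ℕ) : FG n 0 l →* FG n k l :=
  FreeGroup.lift fun g => match g with
    | Sum.inl i => FreeGroup.of (Sum.inl i)
    | Sum.inr (Sum.inl _) => 1
    | Sum.inr (Sum.inr m) => FreeGroup.of (Sum.inr (Sum.inr m))

/-- The endomorphism `x_i ↦ x_i p_i`. -/
def eHom (n k l : ℕ) (p : Fin n → FreeGroup (Fin k)) : FG n k l →* FG n k l :=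
  FreeGroup.lift fun g => match g with
    | Sum.inl i => FreeGroup.of (Sum.inl i) * inY n k l (p i)
    | Sum.inr s => FreeGroup.of (Sum.inr s)

theorem eHom_x (p : Fin n → FreeGroup (Fin k)) (i : Fin n) :
    eHom n k l p (FreeGroup.of (Sum.inl i)) = FreeGroup.of (Sum.inl i) * inY n k l (p i) := by
  simp [eHom]

theorem eHom_s (p : Fin n → FreeGroup (Fin k)) (s : Fin k ⊕ Fin l) :
    eHom n k l p (FreeGroup.of (Sum.inr s)) = FreeGroup.of (Sum.inr s) := by
  simp [eHom]

theorem eHom_inY (p : Fin n → FreeGroup (Fin k)) (w : FreeGroup (Fin k)) :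
    eHom n k l p (inY n k l w) = inY n k l w := by
  have : (eHom n k l p).comp (inY n k l) = inY n k l := by
    apply FreeGroup.ext_hom
    intro j
    simp [inY, eHom_s]
  exact DFunLike.congr_fun this w

theorem retY_inY (w : FreeGroup (Fin k)) : retY n k l (inY n k l w) = w := by
  have : (retY n k l).comp (inY n k l) = MonoidHom.id _ := by
    apply FreeGroup.ext_hom
    intro j
    simp [inY, retY]
  exact DFunLike.congr_fun this w

theorem proj_inY (w : FreeGroup (Fin k)) : proj n k l (inY n k l w) = 1 := by
  have : (proj n k l).comp (inY n k l) = 1 := by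
    apply FreeGroup.ext_hom
    intro j
    simp [inY, proj]
  exact DFunLike.congr_fun this w

theorem eHom_one : eHom n k l 1 = MonoidHom.id _ := by
  apply FreeGroup.ext_hom
  rintro (i | s)
  · simp [eHom_x]
  · simp [eHom_s]

theorem eHom_mul (p q : Fin n → FreeGroup (Fin k)) :
    (eHom n k l p).comp (eHom n k l q) = eHom n k l (p * q) := by
  apply FreeGroup.ext_hom
  rintro (i | s)
  · simp [eHom_x, eHom_inY, mul_assoc]
  · simp [eHom_s]

/-- The automorphism `x_i ↦ x_i p_i`, as a homomorphism in `p`. -/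
def eAut (n k l : ℕ) : (Fin n → FreeGroup (Fin k)) →* MulAut (FG n k l) where
  toFun p := MonoidHom.toMulEquiv (eHom n k l p) (eHom n k l p⁻¹)
    (by rw [eHom_mul, inv_mul_cancel, eHom_one]) (by rw [eHom_mul, mul_inv_cancel, eHom_one])
  map_one' := by
    ext w
    exact DFunLike.congr_fun eHom_one w
  map_mul' p q := by
    ext w
    exact (DFunLike.congr_fun (eHom_mul p q) w).symm

theorem eAut_apply (p : Fin n → FreeGroup (Fin k)) (w : FG n k l) :
    eAut n k l p w = eHom n k l p w := rfl

theorem abAut_of {G : Type*} [Group G] (f : MulAut G) (w : G) :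
    abAut G f (Abelianization.of w) = Abelianization.of (f w) := rfl

theorem eAut_mem (p : Fin n → FreeGroup (Fin k)) : eAut n k l p ∈ K n k l := by
  refine ⟨fun s => ?_, fun w => ?_⟩
  · rw [eAut_apply, eHom_s]
  · have : (proj n k l).comp (eHom n k l p) = proj n k l := by
      apply FreeGroup.ext_hom
      rintro (i | s)
      · simp [eHom_x, proj_inY]
      · simp [eHom_s]
    exact DFunLike.congr_fun this w

theorem of_decomp (u : FG n k l) : Abelianization.of u =
    Abelianization.of (inY n k l (retY n k l u)) *
      Abelianization.of (secP n k l (proj n k l u)) := by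
  have : (Abelianization.of : FG n k l →* _) =
      (Abelianization.of.comp ((inY n k l).comp (retY n k l))) *
        (Abelianization.of.comp ((secP n k l).comp (proj n k l))) := by
    apply FreeGroup.ext_hom
    rintro (i | j | m) <;> simp [inY, retY, secP, proj]
  exact DFunLike.congr_fun this u

theorem mulAut_ab_ext {f g : MulAut (Abelianization (FG n k l))}
    (h : ∀ v, f (Abelianization.of (FreeGroup.of v)) = g (Abelianization.of (FreeGroup.of v))) :
    f = g := by
  apply MulEquiv.toMonoidHom_injective
  apply Abelianization.hom_ext
  apply FreeGroup.ext_hom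
  exact h

theorem range_eq : ((abAut (FG n k l)).comp (eAut n k l)).range =
    Subgroup.map (abAut (FG n k l)) (K n k l) := by
  ext φ
  constructor
  · rintro ⟨p, rfl⟩
    exact ⟨_, eAut_mem p, rfl⟩
  · rintro ⟨f, ⟨hA, hP⟩, rfl⟩
    refine ⟨fun i => retY n k l ((FreeGroup.of (Sum.inl i))⁻¹ * f (FreeGroup.of (Sum.inl i))), ?_⟩
    apply mulAut_ab_ext
    rintro (i | s)
    · rw [MonoidHom.comp_apply, abAut_of, abAut_of, eAut_apply, eHom_x]
      have h := of_decomp ((FreeGroup.of (Sum.inl i))⁻¹ * f (FreeGroup.of (Sum.inl i)))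
      have h1 : proj n k l ((FreeGroup.of (Sum.inl i))⁻¹ * f (FreeGroup.of (Sum.inl i))) = 1 := by
        rw [map_mul, hP, map_inv, inv_mul_cancel]
      rw [h1, map_one, map_one, mul_one] at h
      rw [map_mul, ← h, ← map_mul, mul_inv_cancel_left]
    · rw [MonoidHom.comp_apply, abAut_of, abAut_of, eAut_apply, eHom_s]
      exact isConj_iff_eq.mp ((Abelianization.of).map_isConj (hA s))

/-- Coordinatewise abelianization. -/
def qHom (n k : ℕ) : (Fin n → FreeGroup (Fin k)) →* (Fin n → Abelianization (FreeGroup (Fin k))) where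
  toFun p i := Abelianization.of (p i)
  map_one' := by ext i; simp
  map_mul' p q := by ext i; simp

theorem qHom_surj : Function.Surjective (qHom n k) := by
  intro a
  choose p hp using fun i => QuotientGroup.mk_surjective (a i)
  exact ⟨p, funext hp⟩

theorem ker_eq : ((abAut (FG n k l)).comp (eAut n k l)).ker = (qHom n k).ker := by
  ext p
  rw [MonoidHom.mem_ker, MonoidHom.mem_ker]
  constructor
  · intro h
    funext i
    have h1 := DFunLike.congr_fun h (Abelianization.of (FreeGroup.of (Sum.inl i)))
    rw [MonoidHom.comp_apply, abAut_of, eAut_apply, eHom_x, map_mul, MulAut.one_apply,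
      mul_eq_left] at h1
    have h2 := congrArg (Abelianization.map (retY n k l)) h1
    rw [Abelianization.map_of, retY_inY, map_one] at h2
    exact h2
  · intro h
    apply mulAut_ab_ext
    rintro (i | s)
    · rw [MonoidHom.comp_apply, abAut_of, eAut_apply, eHom_x, map_mul, MulAut.one_apply,
        mul_eq_left]
      have h1 : Abelianization.of (p i) = 1 := congrFun h i
      have h2 := congrArg (Abelianization.map (inY n k l)) h1
      rwa [Abelianization.map_of, map_one] at h2
    · rw [MonoidHom.comp_apply, abAut_of, eAut_apply, eHom_s, MulAut.one_apply]

/-- The abelianized free group. -/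
noncomputable def abEquiv (k : ℕ) :
    Abelianization (FreeGroup (Fin k)) ≃* Multiplicative (Fin k → ℤ) :=
  AddEquiv.toMultiplicativeRight (((FreeAbelianGroup.equivFinsupp (Fin k)).trans
    (Finsupp.linearEquivFunOnFinite ℤ ℤ (Fin k)).toAddEquiv :
      FreeAbelianGroup (Fin k) ≃+ (Fin k → ℤ)))

theorem target_equiv (n k : ℕ) : Nonempty ((Fin n → Abelianization (FreeGroup (Fin k))) ≃*
    Multiplicative (Fin (n * k) → ℤ)) := by
  refine ⟨(MulEquiv.piCongrRight fun _ => abEquiv k).trans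
    { toFun := fun a => Multiplicative.ofAdd fun c =>
        Multiplicative.toAdd (a (finProdFinEquiv.symm c).1) (finProdFinEquiv.symm c).2
      invFun := fun b i => Multiplicative.ofAdd fun j =>
        Multiplicative.toAdd b (finProdFinEquiv (i, j))
      left_inv := ?_
      right_inv := ?_
      map_mul' := ?_ }⟩
  · intro a
    simp only [toAdd_ofAdd, Equiv.symm_apply_apply]
    rfl
  · intro b
    simp only [toAdd_ofAdd, Prod.mk.eta, Equiv.apply_symm_apply]
    rfl
  · intro a b
    rfl

/-- The image of `K_{n,k,l}` under the natural map `Aut(F) → Aut(F^{ab})` is a free abelian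
group of rank `nk`. -/
theorem action_on_homology_image (n k l : ℕ) :
    Nonempty (↥(Subgroup.map (abAut (FG n k l)) (K n k l)) ≃*
      Multiplicative (Fin (n * k) → ℤ)) := by
  obtain ⟨t⟩ := target_equiv n k
  exact ⟨(MulEquiv.subgroupCongr (range_eq (n := n) (k := k) (l := l))).symm.trans
    ((QuotientGroup.quotientKerEquivRange _).symm.trans
      ((QuotientGroup.quotientMulEquivOfEq ker_eq).trans
        ((QuotientGroup.quotientKerEquivOfSurjective _ qHom_surj).trans t)))⟩

end Birman
end

section
/- Let V̄ = F^{ab} with the image of a word u denoted ū, and let V̄_Y ≤ V̄ be the subgroup generated by ȳ_1,…,ȳ_k. Fix c = z_j ∈ Z. Then: (i) for every f ∈ K_{n,k,l} there exists w ∈ F with f(c) = w c w^{-1}, and for any such w the image w̄ lies in the subgroup ⟨V̄_Y, c̄⟩ of V̄; (ii) the class of w̄ in ⟨V̄_Y, c̄⟩/⟨c̄⟩ is independent of the choice of w; and (iii) the resulting map J_c : K_{n,k,l} → ⟨V̄_Y, c̄⟩/⟨c̄⟩, sending f to this class, is a group homomorphism. -/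
namespace Birman

/-- `V̄_Y ≤ V̄ = F^{ab}`: the subgroup generated by the images of `y_1, …, y_k`. -/
def VY (n k l : ℕ) : Subgroup (Abelianization (FG n k l)) :=
  Subgroup.closure (Set.range fun j : Fin k => Abelianization.of (FreeGroup.of (yg n k l j)))

theorem mem_zpowers_of_commute_of {α : Type*} [DecidableEq α] (a : α) :
    ∀ (N : ℕ) (v : FreeGroup α), v.norm ≤ N → Commute v (FreeGroup.of a) →
      v ∈ Subgroup.zpowers (FreeGroup.of a) := by
  intro N
  induction N with
  | zero =>
    intro v hv _
    have : v = 1 := FreeGroup.norm_eq_zero.1 (Nat.le_zero.1 hv)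
    rw [this]; exact one_mem _
  | succ N ih =>
    intro v hv hc
    have hvL : FreeGroup.mk v.toWord = v := FreeGroup.mk_toWord
    have hlen : v.toWord.length ≤ N + 1 := hv
    have hred : FreeGroup.reduce v.toWord = v.toWord := FreeGroup.reduce_toWord v
    generalize v.toWord = L at hvL hlen hred
    rcases L with _ | ⟨⟨b, e⟩, tl⟩
    · rw [← hvL]; exact one_mem _
    · by_cases hb : b = a
      · subst hb
        have hsplit : v = FreeGroup.mk [(b, e)] * FreeGroup.mk tl := by
          rw [← hvL, FreeGroup.mul_mk]; rfl
        have hmem : FreeGroup.mk [(b, e)] ∈ Subgroup.zpowers (FreeGroup.of b) := by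
          cases e
          · have : FreeGroup.mk [(b, false)] = (FreeGroup.of b)⁻¹ := rfl
            rw [this]; exact inv_mem (Subgroup.mem_zpowers _)
          · exact Subgroup.mem_zpowers (FreeGroup.of b)
        have hcomm : Commute (FreeGroup.mk [(b, e)]) (FreeGroup.of b) := by
          obtain ⟨m, hm⟩ := hmem
          rw [← hm]; exact (Commute.refl (FreeGroup.of b)).zpow_left m
        have htl : FreeGroup.mk tl ∈ Subgroup.zpowers (FreeGroup.of b) := by
          apply ih
          · refine FreeGroup.norm_mk_le.trans ?_
            simpa using hlen
          · have : FreeGroup.mk tl = (FreeGroup.mk [(b, e)])⁻¹ * v := by rw [hsplit]; group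
            rw [this]; exact hcomm.inv_left.mul_left hc
        rw [hsplit]; exact mul_mem hmem htl
      · exfalso
        have h1 : FreeGroup.mk (((b, e) :: tl) ++ [(a, true)]) =
            FreeGroup.mk ((a, true) :: (b, e) :: tl) := by
          have h := hc.eq
          rw [← hvL] at h
          exact h
        have h2 := FreeGroup.reduce.sound h1
        have h3 : FreeGroup.reduce ((a, true) :: (b, e) :: tl) = (a, true) :: (b, e) :: tl := by
          rw [FreeGroup.reduce.cons, hred]
          have : a ≠ b := fun h => hb h.symm
          simp [this]
        have h4 : FreeGroup.Red (((b, e) :: tl) ++ [(a, true)]) ((a, true) :: (b, e) :: tl) := by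
          rw [← h3, ← h2]; exact FreeGroup.reduce.red
        have h5 := h4.sublist.eq_of_length (by simp)
        simp at h5
        exact hb h5.1.1.symm

theorem commute_of_conj_eq {G : Type*} [Group G] {w w' c : G}
    (h : w * c * w⁻¹ = w' * c * w'⁻¹) : Commute (w'⁻¹ * w) c := by
  have : w'⁻¹ * (w * c * w⁻¹) * w = c * (w'⁻¹ * w) := by rw [h]; group
  rw [Commute, SemiconjBy, ← this]; group

theorem ab_conj_indep {α : Type*} [DecidableEq α] (a : α) {w w' : FreeGroup α}
    (h : w * FreeGroup.of a * w⁻¹ = w' * FreeGroup.of a * w'⁻¹) :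
    Abelianization.of w * (Abelianization.of w')⁻¹ ∈
      Subgroup.zpowers (Abelianization.of (FreeGroup.of a)) := by
  obtain ⟨m, hm⟩ := mem_zpowers_of_commute_of a _ _ le_rfl (commute_of_conj_eq h)
  refine ⟨m, ?_⟩
  have := congrArg Abelianization.of hm
  simp only [map_zpow, map_mul, map_inv] at this
  simp only
  rw [this, mul_comm]

/-- The section of `proj`. -/
def sect (n k l : ℕ) : FG n 0 l →* FG n k l :=
  FreeGroup.lift fun g => match g with
    | Sum.inl i => FreeGroup.of (Sum.inl i)
    | Sum.inr (Sum.inl _) => 1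
    | Sum.inr (Sum.inr m) => FreeGroup.of (Sum.inr (Sum.inr m))

theorem ab_sect_proj (n k l : ℕ) (w : FG n k l) :
    Abelianization.of w * (Abelianization.of (sect n k l (proj n k l w)))⁻¹ ∈ VY n k l := by
  induction w using FreeGroup.induction_on with
  | C1 => simp
  | of x =>
    rcases x with i | j | m
    · simp [proj, sect]
    · have : proj n k l (FreeGroup.of (Sum.inr (Sum.inl j))) = 1 := by simp [proj]
      rw [this]
      simp only [map_one, inv_one, mul_one]
      exact Subgroup.subset_closure ⟨j, rfl⟩
    · simp [proj, sect]
  | inv_of x h =>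
    have := inv_mem h
    simpa [mul_comm] using this
  | mul x y hx hy =>
    have := mul_mem hx hy
    simp only [map_mul, mul_inv]
    rwa [mul_mul_mul_comm]

theorem ab_mem (n k l : ℕ) (j0 : Fin l) (f : MulAut (FG n k l)) (hf : f ∈ K n k l) (w : FG n k l)
    (h : f (FreeGroup.of (zg n k l j0)) = w * FreeGroup.of (zg n k l j0) * w⁻¹) :
    Abelianization.of w ∈
      VY n k l ⊔ Subgroup.zpowers (Abelianization.of (FreeGroup.of (zg n k l j0))) := by
  have hp := hf.2 (FreeGroup.of (zg n k l j0))
  have hz : proj n k l (FreeGroup.of (zg n k l j0)) = FreeGroup.of (zg n 0 l j0) := by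
    simp [proj, zg]
  have hs : sect n k l (FreeGroup.of (zg n 0 l j0)) = FreeGroup.of (zg n k l j0) := by
    simp [sect, zg]
  rw [h, map_mul, map_mul, map_inv, hz] at hp
  have hc : Commute (proj n k l w) (FreeGroup.of (zg n 0 l j0)) := by
    rw [Commute, SemiconjBy]; exact mul_inv_eq_iff_eq_mul.1 hp
  obtain ⟨m, hm⟩ := mem_zpowers_of_commute_of _ _ _ le_rfl hc
  have h1 := ab_sect_proj n k l w
  simp only at hm
  rw [← hm, map_zpow, hs, map_zpow] at h1
  have h2 : (Abelianization.of (FreeGroup.of (zg n k l j0))) ^ m ∈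
      Subgroup.zpowers (Abelianization.of (FreeGroup.of (zg n k l j0))) := ⟨m, rfl⟩
  have := Subgroup.mul_mem_sup h1 h2
  simpa using this

theorem ab_conj {G : Type*} [Group G] {x y : G} (h : IsConj x y) :
    Abelianization.of y = Abelianization.of x := by
  obtain ⟨c, hc⟩ := isConj_iff.1 h
  rw [← hc]; simp [mul_comm]

theorem ab_fix (n k l : ℕ) (j0 : Fin l) (f : MulAut (FG n k l)) (hf : f ∈ K n k l) (w : FG n k l)
    (hw : Abelianization.of w ∈
      VY n k l ⊔ Subgroup.zpowers (Abelianization.of (FreeGroup.of (zg n k l j0)))) :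
    Abelianization.of (f w) = Abelianization.of w := by
  let φ : Abelianization (FG n k l) →* Abelianization (FG n k l) :=
    Abelianization.map f.toMonoidHom
  have hφ : ∀ u, φ (Abelianization.of u) = Abelianization.of (f u) := fun u => rfl
  have hle : VY n k l ⊔ Subgroup.zpowers (Abelianization.of (FreeGroup.of (zg n k l j0))) ≤
      φ.eqLocus (MonoidHom.id _) := by
    refine sup_le ?_ ?_
    · refine (Subgroup.closure_le _).2 ?_
      rintro _ ⟨j, rfl⟩
      exact ab_conj (hf.1 (Sum.inl j))
    · rw [Subgroup.zpowers_le]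
      exact ab_conj (hf.1 (Sum.inr j0))
  exact hle hw

/-- **The Johnson homomorphism `J_c` for `c = z_j ∈ Z`.**  (i) every `f ∈ K_{n,k,l}` sends `c`
to `w c w⁻¹` for some `w` whose image `w̄` lies in `⟨V̄_Y, c̄⟩`; (ii) the class of `w̄` modulo
`⟨c̄⟩` does not depend on the choice of `w`; (iii) `f ↦ [w̄] ∈ ⟨V̄_Y, c̄⟩/⟨c̄⟩` is a group
homomorphism on `K_{n,k,l}`. -/
theorem Jz_well_defined_homomorphism (n k l : ℕ) (j0 : Fin l) :
    (∀ f ∈ K n k l, ∃ w : FG n k l,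
        f (FreeGroup.of (zg n k l j0)) = w * FreeGroup.of (zg n k l j0) * w⁻¹ ∧
        Abelianization.of w ∈
          VY n k l ⊔ Subgroup.zpowers (Abelianization.of (FreeGroup.of (zg n k l j0)))) ∧
    (∀ f ∈ K n k l, ∀ w w' : FG n k l,
        f (FreeGroup.of (zg n k l j0)) = w * FreeGroup.of (zg n k l j0) * w⁻¹ →
        f (FreeGroup.of (zg n k l j0)) = w' * FreeGroup.of (zg n k l j0) * w'⁻¹ →
        Abelianization.of w * (Abelianization.of w')⁻¹ ∈
          Subgroup.zpowers (Abelianization.of (FreeGroup.of (zg n k l j0)))) ∧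
    (∀ f ∈ K n k l, ∀ g ∈ K n k l, ∀ wf wg wfg : FG n k l,
        f (FreeGroup.of (zg n k l j0)) = wf * FreeGroup.of (zg n k l j0) * wf⁻¹ →
        g (FreeGroup.of (zg n k l j0)) = wg * FreeGroup.of (zg n k l j0) * wg⁻¹ →
        (f * g) (FreeGroup.of (zg n k l j0)) = wfg * FreeGroup.of (zg n k l j0) * wfg⁻¹ →
        Abelianization.of wfg * (Abelianization.of wf * Abelianization.of wg)⁻¹ ∈
          Subgroup.zpowers (Abelianization.of (FreeGroup.of (zg n k l j0)))) := by
  refine ⟨?_, ?_, ?_⟩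
  · intro f hf
    obtain ⟨w, hw⟩ := isConj_iff.1 (hf.1 (Sum.inr j0))
    exact ⟨w, hw.symm, ab_mem n k l j0 f hf w hw.symm⟩
  · intro f _ w w' h h'
    exact ab_conj_indep _ (h.symm.trans h')
  · intro f hf g hg wf wg wfg h1 h2 h3
    have h4 : (f * g) (FreeGroup.of (zg n k l j0)) =
        (f wg * wf) * FreeGroup.of (zg n k l j0) * (f wg * wf)⁻¹ := by
      rw [MulAut.mul_apply, h2, map_mul, map_mul, map_inv, h1]; group
    have h5 := ab_conj_indep _ (h3.symm.trans h4)
    rw [map_mul, ab_fix n k l j0 f hf wg (ab_mem n k l j0 g hg wg h2),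
      mul_comm (Abelianization.of wg)] at h5
    exact h5

end Birman
end

section
/- If ṽ, ṽ' ∈ F have the same image in V̄/V̄_Y (where V̄ = F^{ab} and V̄_Y is the subgroup of V̄ generated by ȳ_1,…,ȳ_k), then the elements ṽ y ṽ^{-1} and ṽ' y ṽ'^{-1} of N_Y have the same image in N_Y/M; that is, (ṽ y ṽ^{-1})·(ṽ' y ṽ'^{-1})^{-1} ∈ M. -/
namespace Birman

/-- The distinguished element `y = y_1` of `Y` (for `k ≥ 1`). -/
def y0 (n k l : ℕ) [hk : Fact (0 < k)] : FG n k l :=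
  FreeGroup.of (yg n k l ⟨0, hk.out⟩)

/-- `N_Y`: the normal closure of `Y` in `F_{n,k,l}`. -/
def NY (n k l : ℕ) : Subgroup (FG n k l) :=
  Subgroup.normalClosure (Set.range fun j : Fin k => FreeGroup.of (yg n k l j))

/-- `N_{Y'}`: the normal closure of `Y' = Y \ {y}` in `F_{n,k,l}`. -/
def NY' (n k l : ℕ) [hk : Fact (0 < k)] : Subgroup (FG n k l) :=
  Subgroup.normalClosure
    {w | ∃ j : Fin k, j ≠ ⟨0, hk.out⟩ ∧ w = FreeGroup.of (yg n k l j)}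

/-- The subgroup `M ≤ F` generated by `N_{Y'}`, `[N_Y, N_Y]` and `[N_Y, [F,F]]`. -/
def Msub (n k l : ℕ) [Fact (0 < k)] : Subgroup (FG n k l) :=
  NY' n k l ⊔ ⁅NY n k l, NY n k l⁆ ⊔ ⁅NY n k l, ⁅(⊤ : Subgroup (FG n k l)), ⊤⁆⁆

instance NY_normal (n k l : ℕ) : (NY n k l).Normal :=
  Subgroup.normalClosure_normal

instance NY'_normal (n k l : ℕ) [Fact (0 < k)] : (NY' n k l).Normal :=
  Subgroup.normalClosure_normal

instance Msub_normal (n k l : ℕ) [Fact (0 < k)] : (Msub n k l).Normal := by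
  unfold Msub
  infer_instance

theorem y0_mem_NY (n k l : ℕ) [hk : Fact (0 < k)] : y0 n k l ∈ NY n k l :=
  Subgroup.subset_normalClosure ⟨⟨0, hk.out⟩, rfl⟩

theorem conj_y0_mem_NY (n k l : ℕ) [Fact (0 < k)] (v : FG n k l) :
    v * y0 n k l * v⁻¹ ∈ NY n k l :=
  (NY_normal n k l).conj_mem _ (y0_mem_NY n k l) v

end Birman

namespace Birman

/-- **Lemma (well-definedness of `y^v`).**  If `ṽ, ṽ' ∈ F` have the same image in `V̄/V̄_Y`,
then `ṽ y ṽ⁻¹` and `ṽ' y ṽ'⁻¹` have the same image in `N_Y/M`, i.e.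
`(ṽ y ṽ⁻¹)·(ṽ' y ṽ'⁻¹)⁻¹ ∈ M`. -/
theorem conj_y0_well_defined (n k l : ℕ) [Fact (0 < k)] (v v' : FG n k l)
    (h : (QuotientGroup.mk (Abelianization.of v) :
            Abelianization (FG n k l) ⧸ VY n k l) =
          QuotientGroup.mk (Abelianization.of v')) :
    (v * y0 n k l * v⁻¹) * (v' * y0 n k l * v'⁻¹)⁻¹ ∈ Msub n k l := by
  set M := Msub n k l with hM
  let C : Subgroup (FG n k l) :=
    (Subgroup.centralizer {(QuotientGroup.mk' M) (y0 n k l)}).comap (QuotientGroup.mk' M)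
  have hC : ∀ u, u ∈ C ↔ y0 n k l * u * (y0 n k l)⁻¹ * u⁻¹ ∈ M := by
    intro u
    rw [← QuotientGroup.eq_one_iff (N := M), ← QuotientGroup.mk'_apply, map_mul, map_mul, map_mul,
      map_inv, map_inv, mul_inv_eq_one, mul_inv_eq_iff_eq_mul, Subgroup.mem_comap,
      Subgroup.mem_centralizer_singleton_iff]
    exact eq_comm
  have hN : NY n k l ≤ C := fun u hu => (hC u).2 <|
    Subgroup.mem_sup_left (Subgroup.mem_sup_right
      (Subgroup.commutator_mem_commutator (y0_mem_NY n k l) hu))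
  have hD : ⁅(⊤ : Subgroup (FG n k l)), ⊤⁆ ≤ C := fun u hu => (hC u).2 <|
    Subgroup.mem_sup_right (Subgroup.commutator_mem_commutator (y0_mem_NY n k l) hu)
  have hV : VY n k l ≤ C.map Abelianization.of := by
    refine (Subgroup.closure_le _).2 ?_
    rintro _ ⟨j, rfl⟩
    exact ⟨_, hN (Subgroup.subset_normalClosure ⟨j, rfl⟩), rfl⟩
  rw [QuotientGroup.eq, ← map_inv, ← map_mul] at h
  obtain ⟨c, hc, hcu⟩ := hV h
  have h1 : c⁻¹ * (v⁻¹ * v') ∈ ⁅(⊤ : Subgroup (FG n k l)), ⊤⁆ :=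
    QuotientGroup.eq.1 hcu
  have h2 : v⁻¹ * v' ∈ C := by
    have := C.mul_mem hc (hD h1)
    rwa [mul_inv_cancel_left] at this
  have h3 := (Msub_normal n k l).conj_mem _ ((hC _).1 h2) v
  convert h3 using 1
  group

end Birman
end

section
/- Suppose f ∈ K_{n,k,l} satisfies J'_y(f) = 0, i.e. there exists w ∈ F with f(y) = w y w^{-1} and with the image w̄ of w in V̄ lying in V̄_Y. Then f acts trivially on N_Y/M: for every u ∈ N_Y one has f(u)·u^{-1} ∈ M. Consequently, the map I : {f ∈ K_{n,k,l} : J'_y(f) = 0} → CHom(F/M, N_Y/M) obtained from the Johnson crossed homomorphism construction is a group homomorphism on this subgroup. -/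
namespace Birman

/-- Two elements with the same image under `proj` differ by an element of `NY`. -/
theorem aux_mem_NY (n k l : ℕ) (a b : FG n k l) (h : proj n k l a = proj n k l b) :
    a * b⁻¹ ∈ NY n k l := by
  let s : FG n 0 l →* FG n k l ⧸ NY n k l := FreeGroup.lift fun g => match g with
    | Sum.inl i => QuotientGroup.mk' (NY n k l) (FreeGroup.of (Sum.inl i))
    | Sum.inr (Sum.inl _) => 1
    | Sum.inr (Sum.inr m) => QuotientGroup.mk' (NY n k l) (FreeGroup.of (Sum.inr (Sum.inr m)))
  have hs : s.comp (proj n k l) = QuotientGroup.mk' (NY n k l) := by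
    ext g
    rcases g with i | j | m
    · simp [s, proj]
    · have : FreeGroup.of (Sum.inr (Sum.inl j)) ∈ NY n k l :=
        Subgroup.subset_normalClosure ⟨j, rfl⟩
      have h2 := (QuotientGroup.eq_one_iff _).2 this
      simp [s, proj, h2]
    · simp [s, proj]
  have h1 : QuotientGroup.mk' (NY n k l) a = QuotientGroup.mk' (NY n k l) b := by
    rw [← hs, MonoidHom.comp_apply, MonoidHom.comp_apply, h]
  have h3 : QuotientGroup.mk' (NY n k l) (a * b⁻¹) = 1 := by
    rw [map_mul, map_inv, h1, mul_inv_cancel]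
  exact (QuotientGroup.eq_one_iff _).1 h3

theorem aux_comm_NY (n k l : ℕ) [Fact (0 < k)] {a b : FG n k l}
    (ha : a ∈ NY n k l) (hb : b ∈ NY n k l) : a * b * a⁻¹ * b⁻¹ ∈ Msub n k l := by
  have h : a * b * a⁻¹ * b⁻¹ ∈ Msub n k l :=
    Subgroup.mem_sup_left (Subgroup.mem_sup_right (Subgroup.commutator_mem_commutator ha hb))
  exact h

theorem aux_comm_comm (n k l : ℕ) [Fact (0 < k)] {a b : FG n k l}
    (ha : a ∈ NY n k l) (hb : b ∈ (⁅(⊤ : Subgroup (FG n k l)), (⊤ : Subgroup (FG n k l))⁆ : Subgroup (FG n k l))) :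
    a * b * a⁻¹ * b⁻¹ ∈ Msub n k l := by
  have h : a * b * a⁻¹ * b⁻¹ ∈ Msub n k l :=
    Subgroup.mem_sup_right (Subgroup.commutator_mem_commutator ha hb)
  exact h

theorem aux_VY (n k l : ℕ) (w : FG n k l) (hw : Abelianization.of w ∈ VY n k l) :
    ∃ a ∈ NY n k l, ∃ c ∈ (⁅(⊤ : Subgroup (FG n k l)), (⊤ : Subgroup (FG n k l))⁆ : Subgroup (FG n k l)), w = a * c := by
  have hle : VY n k l ≤ (NY n k l).map Abelianization.of := by
    unfold VY
    rw [Subgroup.closure_le]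
    rintro _ ⟨j, rfl⟩
    exact ⟨_, Subgroup.subset_normalClosure ⟨j, rfl⟩, rfl⟩
  obtain ⟨a, ha, haw⟩ := hle hw
  refine ⟨a, ha, a⁻¹ * w, ?_, by group⟩
  have : a⁻¹ * w ∈ (Abelianization.of : FG n k l →* _).ker := by
    rw [MonoidHom.mem_ker, map_mul, map_inv, haw, inv_mul_cancel]
  rw [Abelianization.ker_of] at this
  exact this

theorem aux_trivial (n k l : ℕ) [hk : Fact (0 < k)] (f : MulAut (FG n k l)) (hf : f ∈ K n k l)
    (w : FG n k l) (hfw : f (y0 n k l) = w * y0 n k l * w⁻¹)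
    (hw : Abelianization.of w ∈ VY n k l) (u : FG n k l) (hu : u ∈ NY n k l) :
    f u * u⁻¹ ∈ Msub n k l := by
  obtain ⟨hA, hP⟩ := hf
  let q := QuotientGroup.mk' (Msub n k l)
  have hq : ∀ x, q x = 1 ↔ x ∈ Msub n k l := fun x => QuotientGroup.eq_one_iff x
  suffices h : NY n k l ≤ (q.comp f.toMonoidHom).eqLocus q by
    have h1 : q (f u) = q u := h hu
    rw [← hq, map_mul, map_inv, h1, mul_inv_cancel]
  unfold NY Subgroup.normalClosure
  rw [Subgroup.closure_le]
  intro x hx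
  obtain ⟨_, ⟨j, rfl⟩, hx⟩ := Group.mem_conjugatesOfSet_iff.1 hx
  obtain ⟨v, rfl⟩ := isConj_iff.1 hx
  change q (f _) = q _
  by_cases hj : j = ⟨0, hk.out⟩
  · subst hj
    change q (f (v * y0 n k l * v⁻¹)) = q (v * y0 n k l * v⁻¹)
    obtain ⟨a, ha, c, hc, rfl⟩ := aux_VY n k l w hw
    have hm : f v * v⁻¹ ∈ NY n k l := aux_mem_NY n k l _ _ (hP v)
    have hy := y0_mem_NY n k l
    have e1 := (hq _).2 (aux_comm_NY n k l hm (conj_y0_mem_NY n k l v))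
    have e2 := (hq _).2 (aux_comm_NY n k l hy ha)
    have e3 := (hq _).2 (aux_comm_comm n k l hy hc)
    simp only [map_mul, map_inv] at e1 e2 e3
    rw [mul_inv_eq_one, mul_inv_eq_iff_eq_mul] at e1 e2 e3
    have e2' : q a * q (y0 n k l) * (q a)⁻¹ = q (y0 n k l) := by rw [← e2]; group
    have e3' : q c * q (y0 n k l) * (q c)⁻¹ = q (y0 n k l) := by rw [← e3]; group
    have e4 : q (f (y0 n k l)) = q (y0 n k l) := by
      rw [hfw]
      simp only [map_mul, map_inv]
      calc _ = q a * (q c * q (y0 n k l) * (q c)⁻¹) * (q a)⁻¹ := by group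
        _ = _ := by rw [e3', e2']
    simp only [map_mul, map_inv, e4]
    calc q (f v) * q (y0 n k l) * (q (f v))⁻¹
        = (q (f v) * (q v)⁻¹ * (q v * q (y0 n k l) * (q v)⁻¹)) * (q (f v) * (q v)⁻¹)⁻¹ := by group
      _ = _ := by rw [e1]; group
  · have hy : FreeGroup.of (yg n k l j) ∈ Msub n k l :=
      Subgroup.mem_sup_left (Subgroup.mem_sup_left
        (Subgroup.subset_normalClosure ⟨j, hj, rfl⟩))
    have hfy : f (FreeGroup.of (yg n k l j)) ∈ Msub n k l := by
      obtain ⟨c, hc⟩ := isConj_iff.1 (hA (Sum.inl j))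
      unfold yg
      rw [← hc]
      exact (Msub_normal n k l).conj_mem _ hy c
    have h1 := (hq _).2 hy
    have h2 := (hq _).2 hfy
    simp only [map_mul, map_inv, h1, h2]
    group

/-- **Lemma (the subgroup `LKer` acts trivially on `N_Y/M`).**  If `f ∈ K_{n,k,l}` satisfies
`J'_y(f) = 0` (i.e. `f(y) = w y w⁻¹` with `w̄ ∈ V̄_Y`), then `f(u)·u⁻¹ ∈ M` for all
`u ∈ N_Y`.  Consequently the Johnson crossed homomorphism `I` restricts to a group
homomorphism on `{f ∈ K_{n,k,l} : J'_y(f) = 0}`: for `f, g` in this subgroup and every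
`u ∈ F`, `I(fg)(u) = I(f)(u)·I(g)(u)` modulo `M`. -/
theorem LKer_trivial_action_and_I_hom (n k l : ℕ) [Fact (0 < k)] :
    (∀ f ∈ K n k l,
      (∃ w : FG n k l, f (y0 n k l) = w * y0 n k l * w⁻¹ ∧ Abelianization.of w ∈ VY n k l) →
      ∀ u ∈ NY n k l, f u * u⁻¹ ∈ Msub n k l) ∧
    (∀ f ∈ K n k l, ∀ g ∈ K n k l,
      (∃ w : FG n k l, f (y0 n k l) = w * y0 n k l * w⁻¹ ∧ Abelianization.of w ∈ VY n k l) →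
      (∃ w : FG n k l, g (y0 n k l) = w * y0 n k l * w⁻¹ ∧ Abelianization.of w ∈ VY n k l) →
      ∀ u : FG n k l,
        (f (g u) * u⁻¹) * ((f u * u⁻¹) * (g u * u⁻¹))⁻¹ ∈ Msub n k l) := by
  refine ⟨fun f hf ⟨w, h1, h2⟩ u hu => aux_trivial n k l f hf w h1 h2 u hu, ?_⟩
  rintro f hf g hg ⟨w, h1, h2⟩ - u
  have hm : g u * u⁻¹ ∈ NY n k l := aux_mem_NY n k l _ _ (hg.2 u)
  have hp : f u * u⁻¹ ∈ NY n k l := aux_mem_NY n k l _ _ (hf.2 u)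
  have t1 := aux_trivial n k l f hf w h1 h2 _ hm
  have t2 := aux_comm_NY n k l hm hp
  have := mul_mem t1 t2
  simp only [map_mul, map_inv] at this
  convert this using 1
  group

end Birman
end
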